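/- For every s ≥ 1, both 4 + K̃(b^s) + K(c^s) ⊆ L(4) and 4 + K(b^s) + K(b^s) ⊆ L(4), where the sums are Minkowski sums of sets of real numbers. -/

import Mathlib

open Filter Set
open scoped Pointwise

noncomputable section

/-- The `n`-th convergent of the continued fraction `[0; a 0, a 1, a 2, …]`. -/
def cfConv : ℕ → (ℕ → ℕ) → ℝ
  | 0, _ => 0
  | n + 1, a => 1 / (a 0 + cfConv n fun i => a (i + 1))

/-- The value `[0; a 0, a 1, a 2, …]` of the infinite continued fraction with
partial quotients `a 0, a 1, …` (the limit of its convergents). -/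
def cfVal (a : ℕ → ℕ) : ℝ := limUnder atTop fun n => cfConv n a

/-- The sequence of partial quotients obtained by concatenating the finite word `b`
with the sequence `θ`. -/
def app (b : List ℕ) (θ : ℕ → ℕ) : ℕ → ℕ := fun n =>
  if h : n < b.length then b.get ⟨n, h⟩ else θ (n - b.length)

/-- `λ_i(θ) = [a_i; a_{i+1}, …] + [0; a_{i-1}, a_{i-2}, …]` for a bi-infinite
sequence `θ` of partial quotients. -/
def lamCF (θ : ℤ → ℕ) (i : ℤ) : ℝ :=
  (θ i : ℝ) + cfVal (fun n => θ (i + 1 + n)) + cfVal (fun n => θ (i - 1 - n))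

/-- The classical Lagrange spectrum. -/
def LSpec : Set ℝ :=
  {x | ∃ θ : ℤ → ℕ, (∀ i, 1 ≤ θ i) ∧
    IsBoundedUnder (· ≤ ·) atTop (lamCF θ) ∧ x = limsup (lamCF θ) atTop}

/-- The classical Markov spectrum. -/
def MSpec : Set ℝ :=
  {x | ∃ θ : ℤ → ℕ, (∀ i, 1 ≤ θ i) ∧
    BddAbove (Set.range (lamCF θ)) ∧ x = ⨆ i, lamCF θ i}

/-- The Lagrange spectrum `L(k)` of sequences with partial quotients in `{1, …, k}`. -/
def LSpecK (k : ℕ) : Set ℝ :=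
  {x | ∃ θ : ℤ → ℕ, (∀ i, 1 ≤ θ i ∧ θ i ≤ k) ∧ x = limsup (lamCF θ) atTop}

/-- The Markov spectrum `M(k)` of sequences with partial quotients in `{1, …, k}`. -/
def MSpecK (k : ℕ) : Set ℝ :=
  {x | ∃ θ : ℤ → ℕ, (∀ i, 1 ≤ θ i ∧ θ i ≤ k) ∧ x = ⨆ i, lamCF θ i}

/-- The forbidden pairs of consecutive partial quotients. -/
def badPairs : Set (ℕ × ℕ) := {(1, 4), (2, 4)}

/-- The set `D` of sequences with entries in `{1,2,3,4}` avoiding the pairs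
`(1,4)` and `(2,4)`. -/
def Dset : Set (ℕ → ℕ) :=
  {θ | (∀ n, θ n ∈ ({1, 2, 3, 4} : Set ℕ)) ∧ ∀ n, (θ n, θ (n + 1)) ∉ badPairs}

/-- The Cantor set `K(b) = {[0; b, θ] : θ ∈ D, (b_s, θ_1) ∉ {(1,4),(2,4)}}`. -/
def Kb (b : List ℕ) : Set ℝ :=
  {x | ∃ θ ∈ Dset, (∀ d, b.getLast? = some d → (d, θ 0) ∉ badPairs) ∧
    x = cfVal (app b θ)}

/-- The set `K̃(b) ⊆ K(b)` of values `[0; b, θ]` with moreover `(θ_1, θ_2) ≠ (1,3)`. -/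
def Ktil (b : List ℕ) : Set ℝ :=
  {x | ∃ θ ∈ Dset, (∀ d, b.getLast? = some d → (d, θ 0) ∉ badPairs) ∧
    (θ 0, θ 1) ≠ (1, 3) ∧ x = cfVal (app b θ)}

/-- The word `b^s = (1,4)_s`. -/
def bW (s : ℕ) : List ℕ := (List.replicate s [1, 4]).flatten

/-- The word `c^s = (1,4)_{s-1}, 1, 3`. -/
def cW (s : ℕ) : List ℕ := bW (s - 1) ++ [1, 3]

/-- The periodic sequence `\overline{1,3}`. -/
def per13 : ℕ → ℕ := fun n => if n % 2 = 0 then 1 else 3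

/-- The periodic sequence `\overline{3,1}`. -/
def per31 : ℕ → ℕ := fun n => if n % 2 = 0 then 3 else 1

open scoped Topology

/-- All partial quotients lie in `{1, 2, 3, 4}`. -/
def Digits (a : ℕ → ℕ) : Prop := ∀ n, 1 ≤ a n ∧ a n ≤ 4

lemma Digits.tail {a : ℕ → ℕ} (ha : Digits a) : Digits fun i => a (i + 1) :=
  fun n => ha (n + 1)

lemma Digits.cast_bounds {a : ℕ → ℕ} (ha : Digits a) (n : ℕ) :
    (1 : ℝ) ≤ a n ∧ (a n : ℝ) ≤ 4 :=
  ⟨by exact_mod_cast (ha n).1, by exact_mod_cast (ha n).2⟩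

lemma one_div_add_mem {d t : ℝ} (hd : 1 ≤ d) (ht : 0 ≤ t) :
    0 ≤ 1 / (d + t) ∧ 1 / (d + t) ≤ 1 := by
  refine ⟨by positivity, ?_⟩
  rw [div_le_one (by linarith)]
  linarith

lemma cfConv_mem (n : ℕ) : ∀ {a : ℕ → ℕ}, Digits a → 0 ≤ cfConv n a ∧ cfConv n a ≤ 1 := by
  induction n with
  | zero => intro a _; simp [cfConv]
  | succ n ih => exact fun ha => one_div_add_mem (ha.cast_bounds 0).1 (ih ha.tail).1

lemma fifth_le_cfConv {n : ℕ} (hn : 1 ≤ n) {a : ℕ → ℕ} (ha : Digits a) :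
    1 / 5 ≤ cfConv n a := by
  obtain ⟨n, rfl⟩ := Nat.exists_eq_add_of_le' hn
  have h := cfConv_mem n ha.tail
  have h0 := ha.cast_bounds 0
  exact one_div_le_one_div_of_le (by linarith) (by linarith)

lemma abs_one_div_sub_le {d x y : ℝ} (hd : 1 ≤ d) (hx : 1 / 5 ≤ x) (hy : 1 / 5 ≤ y) :
    |1 / (d + x) - 1 / (d + y)| ≤ 25 / 36 * |x - y| := by
  have hx' : 0 < d + x := by linarith
  have hy' : 0 < d + y := by linarith
  have h : 1 / (d + x) - 1 / (d + y) = (y - x) / ((d + x) * (d + y)) := by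
    field_simp
    ring
  rw [h, abs_div, abs_of_pos (mul_pos hx' hy'), abs_sub_comm, div_le_iff₀ (by positivity)]
  have : 36 / 25 ≤ (d + x) * (d + y) := by nlinarith
  nlinarith [abs_nonneg (x - y)]

lemma abs_cfConv_sub_le (k : ℕ) : ∀ {a b : ℕ → ℕ}, Digits a → Digits b →
    (∀ i < k, a i = b i) → ∀ {n m : ℕ}, k + 1 ≤ n → k + 1 ≤ m →
    |cfConv n a - cfConv m b| ≤ (25 / 36) ^ k := by
  induction k with
  | zero =>
    intro a b ha hb _ n m _ _
    have h1 := cfConv_mem n ha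
    have h2 := cfConv_mem m hb
    rw [abs_le]
    constructor <;> simp <;> linarith
  | succ k ih =>
    intro a b ha hb hab n m hn hm
    obtain ⟨n, rfl⟩ := Nat.exists_eq_add_of_le' (show 1 ≤ n by omega)
    obtain ⟨m, rfl⟩ := Nat.exists_eq_add_of_le' (show 1 ≤ m by omega)
    have h := ih ha.tail hb.tail (fun i hi => hab (i + 1) (by omega))
      (n := n) (m := m) (by omega) (by omega)
    have h' := abs_one_div_sub_le (ha.cast_bounds 0).1
      (fifth_le_cfConv (n := n) (by omega) ha.tail) (fifth_le_cfConv (n := m) (by omega) hb.tail)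
    have h0 := hab 0 (by omega)
    simp only [cfConv]
    rw [← h0, pow_succ]
    linarith

lemma tendsto_cfConv {a : ℕ → ℕ} (ha : Digits a) :
    Tendsto (fun n => cfConv n a) atTop (𝓝 (cfVal a)) := by
  have hc : CauchySeq fun n => cfConv (n + 1) a := by
    refine cauchySeq_of_le_tendsto_0 (fun n => (25 / 36 : ℝ) ^ n) (fun n m N hn hm => ?_)
      (tendsto_pow_atTop_nhds_zero_of_lt_one (by norm_num) (by norm_num))
    rw [Real.dist_eq]
    exact abs_cfConv_sub_le N ha ha (fun _ _ => rfl) (by omega) (by omega)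
  obtain ⟨x, hx⟩ := cauchySeq_tendsto_of_complete hc
  exact tendsto_nhds_limUnder ⟨x, (tendsto_add_atTop_iff_nat 1).mp hx⟩

lemma cfVal_mem {a : ℕ → ℕ} (ha : Digits a) : 0 ≤ cfVal a ∧ cfVal a ≤ 1 :=
  ⟨ge_of_tendsto' (tendsto_cfConv ha) fun n => (cfConv_mem n ha).1,
    le_of_tendsto' (tendsto_cfConv ha) fun n => (cfConv_mem n ha).2⟩

lemma cfVal_eq {a : ℕ → ℕ} (ha : Digits a) :
    cfVal a = 1 / (a 0 + cfVal fun i => a (i + 1)) := by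
  have h1 := (tendsto_add_atTop_iff_nat 1).mpr (tendsto_cfConv ha)
  have h2 : Tendsto (fun n => cfConv (n + 1) a) atTop
      (𝓝 (1 / (a 0 + cfVal fun i => a (i + 1)))) := by
    refine tendsto_const_nhds.div (tendsto_const_nhds.add (tendsto_cfConv ha.tail)) ?_
    have := (ha.cast_bounds 0).1
    have := (cfVal_mem ha.tail).1
    linarith
  exact tendsto_nhds_unique h1 h2

lemma abs_cfVal_sub_le {a b : ℕ → ℕ} (ha : Digits a) (hb : Digits b) {k : ℕ}
    (hab : ∀ i < k, a i = b i) : |cfVal a - cfVal b| ≤ (25 / 36) ^ k := by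
  refine le_of_tendsto ((tendsto_cfConv ha).sub (tendsto_cfConv hb)).abs ?_
  filter_upwards [eventually_ge_atTop (k + 1)] with n hn
  exact abs_cfConv_sub_le k ha hb hab hn hn

lemma cfVal_le_one_div {a : ℕ → ℕ} (ha : Digits a) {d : ℕ} (hd : 1 ≤ d) (h : d ≤ a 0) :
    cfVal a ≤ 1 / d := by
  rw [cfVal_eq ha]
  have h1 : (d : ℝ) ≤ a 0 := by exact_mod_cast h
  have h2 : (1 : ℝ) ≤ d := by exact_mod_cast hd
  have := (cfVal_mem ha.tail).1
  exact one_div_le_one_div_of_le (by linarith) (by linarith)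

/-- The action `[0; θ] ↦ [0; 1, 4, θ]`. -/
def stepOneFour (t : ℝ) : ℝ := 1 / (1 + 1 / (4 + t))

lemma stepOneFour_eq {t : ℝ} (ht : 0 ≤ t) : stepOneFour t = 1 - 1 / (5 + t) := by
  unfold stepOneFour
  have h : 4 + t ≠ 0 := by linarith
  have h' : 5 + t ≠ 0 := by linarith
  have h'' : 1 + (4 + t) ≠ 0 := by linarith
  have h3 : 4 + t + 1 ≠ 0 := by linarith
  field_simp
  ring

lemma four_fifths_le_stepOneFour {t : ℝ} (ht : 0 ≤ t) : 4 / 5 ≤ stepOneFour t := by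
  rw [stepOneFour_eq ht]
  have : 1 / (5 + t) ≤ 1 / 5 := one_div_le_one_div_of_le (by norm_num) (by linarith)
  linarith

lemma stepOneFour_mono {x y : ℝ} (hx : 0 ≤ x) (hxy : x ≤ y) :
    stepOneFour x ≤ stepOneFour y := by
  rw [stepOneFour_eq hx, stepOneFour_eq (hx.trans hxy)]
  have : 1 / (5 + y) ≤ 1 / (5 + x) := one_div_le_one_div_of_le (by linarith) (by linarith)
  linarith

lemma stepOneFour_sub_antitone {x y : ℝ} (hx : 0 ≤ x) (hxy : x ≤ y) :
    stepOneFour y - y ≤ stepOneFour x - x := by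
  rw [stepOneFour_eq hx, stepOneFour_eq (hx.trans hxy)]
  have hy : 0 ≤ y := hx.trans hxy
  have h : 1 / (5 + x) - 1 / (5 + y) = (y - x) / ((5 + x) * (5 + y)) := by
    field_simp
    ring
  have : (y - x) / ((5 + x) * (5 + y)) ≤ y - x :=
    div_le_self (by linarith) (by nlinarith)
  linarith

lemma iterate_nonneg {t : ℝ} (ht : 0 ≤ t) (n : ℕ) : 0 ≤ stepOneFour^[n] t := by
  induction n with
  | zero => exact ht
  | succ n ih =>
    rw [Function.iterate_succ_apply']
    linarith [four_fifths_le_stepOneFour ih]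

lemma four_fifths_le_iterate {t : ℝ} (ht : 0 ≤ t) {n : ℕ} (hn : 1 ≤ n) :
    4 / 5 ≤ stepOneFour^[n] t := by
  obtain ⟨n, rfl⟩ := Nat.exists_eq_add_of_le' hn
  rw [Function.iterate_succ_apply']
  exact four_fifths_le_stepOneFour (iterate_nonneg ht n)

lemma iterate_mono_right {x y : ℝ} (hx : 0 ≤ x) (hxy : x ≤ y) (n : ℕ) :
    stepOneFour^[n] x ≤ stepOneFour^[n] y := by
  induction n with
  | zero => exact hxy
  | succ n ih =>
    rw [Function.iterate_succ_apply', Function.iterate_succ_apply']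
    exact stepOneFour_mono (iterate_nonneg hx n) ih

lemma iterate_mono_left {t : ℝ} (ht : 0 ≤ t) (ht' : t ≤ 4 / 5) :
    Monotone fun n => stepOneFour^[n] t := by
  refine monotone_nat_of_le_succ fun n => ?_
  rw [Function.iterate_succ_apply]
  exact iterate_mono_right ht (ht'.trans (four_fifths_le_stepOneFour ht)) n

lemma iterate_le_iterate {u v : ℝ} (hu : 0 ≤ u) (hu' : u ≤ 4 / 5) (hv : 0 ≤ v)
    (hv' : v ≤ 4 / 5) {i j : ℕ} (h : j < i ∨ j = i ∧ v ≤ u) :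
    stepOneFour^[j] v ≤ stepOneFour^[i] u := by
  rcases Nat.lt_or_ge j i with hji | hij
  · have h1 : stepOneFour^[j] v ≤ stepOneFour^[j + 1] u := by
      rw [Function.iterate_succ_apply]
      exact iterate_mono_right hv (hv'.trans (four_fifths_le_stepOneFour hu)) j
    exact h1.trans (iterate_mono_left hu hu' hji)
  · obtain rfl : j = i := by omega
    exact iterate_mono_right hv (h.resolve_left (lt_irrefl _)).2 j

/-- Moving steps of the orbit of `v` to the orbit of `u` does not increase the sum, provided the
orbit of `u` has already overtaken. -/
lemma iterate_add_le_of_le {u v : ℝ} (hv : 0 ≤ v) {a b : ℕ}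
    (h : ∀ i j, a ≤ i → j < b → stepOneFour^[j] v ≤ stepOneFour^[i] u) (k : ℕ) (hk : k ≤ b) :
    stepOneFour^[a + k] u + stepOneFour^[b - k] v ≤ stepOneFour^[a] u + stepOneFour^[b] v := by
  induction k with
  | zero => simp
  | succ k ih =>
    have h1 := ih (by omega)
    have h2 := stepOneFour_sub_antitone (iterate_nonneg hv (b - (k + 1)))
      (h (a + k) (b - (k + 1)) (by omega) (by omega))
    rw [← Function.iterate_succ_apply' stepOneFour, ← Function.iterate_succ_apply' stepOneFour,
      show (b - (k + 1)).succ = b - k by omega] at h2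
    rw [show a + (k + 1) = (a + k).succ by omega]
    linarith

lemma iterate_add_le {u v : ℝ} (hu : 0 ≤ u) (hu' : u ≤ 4 / 5) (hv : 0 ≤ v) (hv' : v ≤ 4 / 5)
    {a b : ℕ} (hab : a = b ∨ a + 1 = b ∧ v ≤ u) {j : ℕ} (hj : j ≤ a + b) :
    stepOneFour^[j] u + stepOneFour^[a + b - j] v ≤ stepOneFour^[a] u + stepOneFour^[b] v := by
  rcases le_total a j with h | h
  · have := iterate_add_le_of_le (u := u) (v := v) hv (a := a) (b := b)
      (fun i l hi hl => iterate_le_iterate hu hu' hv hv' (by grind)) (j - a) (by omega)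
    rwa [show a + (j - a) = j by omega, show b - (j - a) = a + b - j by omega] at this
  · have := iterate_add_le_of_le (u := v) (v := u) hu (a := b) (b := a)
      (fun i l hi hl => iterate_le_iterate hv hv' hu hu' (by omega)) (a - j) (by omega)
    rw [show b + (a - j) = a + b - j by omega, show a - (a - j) = j by omega] at this
    linarith

lemma lamCF_le {θ : ℤ → ℕ} (hθ : ∀ i, 1 ≤ θ i ∧ θ i ≤ 4) (i : ℤ) : lamCF θ i ≤ θ i + 2 := by
  have h1 := (cfVal_mem (a := fun n : ℕ => θ (i + 1 + n)) fun n => hθ _).2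
  have h2 := (cfVal_mem (a := fun n : ℕ => θ (i - 1 - n)) fun n => hθ _).2
  unfold lamCF
  linarith

lemma lamCF_le_of_three_le_left {θ : ℤ → ℕ} (hθ : ∀ i, 1 ≤ θ i ∧ θ i ≤ 4) {i : ℤ}
    (h : 3 ≤ θ (i - 1)) : lamCF θ i ≤ 16 / 3 := by
  have h0 : (θ i : ℝ) ≤ 4 := by exact_mod_cast (hθ i).2
  have h1 := (cfVal_mem (a := fun n : ℕ => θ (i + 1 + n)) fun n => hθ _).2
  have h2 := cfVal_le_one_div (a := fun n : ℕ => θ (i - 1 - n)) (fun n => hθ _)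
    (d := 3) (by norm_num) (by simpa using h)
  unfold lamCF
  push_cast at h2
  linarith

lemma lamCF_le_of_three_le_right {θ : ℤ → ℕ} (hθ : ∀ i, 1 ≤ θ i ∧ θ i ≤ 4) {i : ℤ}
    (h : 3 ≤ θ (i + 1)) : lamCF θ i ≤ 16 / 3 := by
  have h0 : (θ i : ℝ) ≤ 4 := by exact_mod_cast (hθ i).2
  have h1 := (cfVal_mem (a := fun n : ℕ => θ (i - 1 - n)) fun n => hθ _).2
  have h2 := cfVal_le_one_div (a := fun n : ℕ => θ (i + 1 + n)) (fun n => hθ _)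
    (d := 3) (by norm_num) (by simpa using h)
  unfold lamCF
  push_cast at h2
  linarith

/-- Concatenation of the windows `V (p - k), …, V (p + k)`, `k = 0, 1, 2, …`; the `k`-th window
occupies the positions in `[k ^ 2, (k + 1) ^ 2)`. -/
def windows (V : ℤ → ℕ) (p : ℤ) (i : ℤ) : ℕ :=
  V (p + i - (Nat.sqrt i.toNat) ^ 2 - Nat.sqrt i.toNat)

lemma windows_apply (V : ℤ → ℕ) (p : ℤ) {k : ℕ} {m : ℤ} (h1 : -k ≤ m) (h2 : m ≤ k) :
    windows V p (k ^ 2 + k + m) = V (p + m) := by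
  have h : Nat.sqrt ((k : ℤ) ^ 2 + k + m).toNat = k := by
    obtain ⟨l, hl⟩ := Int.eq_ofNat_of_zero_le (show 0 ≤ k + m by linarith)
    have : ((k : ℤ) ^ 2 + k + m).toNat = k * k + l := by
      have : (k : ℤ) ^ 2 + k + m = ((k * k + l : ℕ) : ℤ) := by
        push_cast
        linarith
      rw [this, Int.toNat_natCast]
    rw [this]
    exact Nat.sqrt_add_eq k (by omega)
  unfold windows
  rw [h]
  congr 1
  ring

lemma abs_lamCF_windows_sub_le {V : ℤ → ℕ} (hV : ∀ i, 1 ≤ V i ∧ V i ≤ 4) (p : ℤ)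
    {k M n : ℕ} (hk : M + n ≤ k) {m : ℤ} (hm : |m| ≤ M) :
    |lamCF (windows V p) (k ^ 2 + k + m) - lamCF V (p + m)| ≤ 2 * (25 / 36) ^ n := by
  rw [abs_le] at hm
  have hW : ∀ i, 1 ≤ windows V p i ∧ windows V p i ≤ 4 := fun i => hV _
  have h0 := windows_apply V p (k := k) (m := m) (by omega) (by omega)
  have h1 := abs_cfVal_sub_le (a := fun j : ℕ => windows V p (k ^ 2 + k + m + 1 + j))
    (b := fun j : ℕ => V (p + m + 1 + j)) (fun _ => hW _) (fun _ => hV _) (k := n)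
    (fun j hj => by
      have := windows_apply V p (k := k) (m := m + 1 + j) (by omega) (by omega)
      simpa only [← add_assoc] using this)
  have h2 := abs_cfVal_sub_le (a := fun j : ℕ => windows V p (k ^ 2 + k + m - 1 - j))
    (b := fun j : ℕ => V (p + m - 1 - j)) (fun _ => hW _) (fun _ => hV _) (k := n)
    (fun j hj => by
      have := windows_apply V p (k := k) (m := m - 1 - j) (by omega) (by omega)
      simpa only [← add_sub_assoc] using this)
  unfold lamCF
  rw [h0]
  rw [abs_le] at *
  constructor <;> linarith

lemma exists_window {i : ℤ} {K : ℕ} (hi : (K : ℤ) ^ 2 ≤ i) :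
    ∃ k : ℕ, K ≤ k ∧ ∃ m : ℤ, -k ≤ m ∧ m ≤ k ∧ i = k ^ 2 + k + m := by
  obtain ⟨l, rfl⟩ := Int.eq_ofNat_of_zero_le ((sq_nonneg _).trans hi)
  refine ⟨l.sqrt, Nat.le_sqrt'.mpr (by exact_mod_cast hi), l - (l.sqrt ^ 2 + l.sqrt), ?_, ?_,
    by ring⟩
  · have : ((l.sqrt ^ 2 : ℕ) : ℤ) ≤ l := by exact_mod_cast Nat.sqrt_le' l
    push_cast at this
    linarith
  · have h : l ≤ l.sqrt * l.sqrt + l.sqrt + l.sqrt := Nat.sqrt_le_add l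
    have : (l : ℤ) ≤ l.sqrt * l.sqrt + l.sqrt + l.sqrt := by exact_mod_cast h
    linarith [sq (l.sqrt : ℤ)]

/-- A Markov value attained at `p` is a Lagrange value as soon as, away from `p`, every digit `4`
is next to a digit at least `3` on the side of `p`. -/
lemma lamCF_mem_LSpecK {V : ℤ → ℕ} (hV : ∀ i, 1 ≤ V i ∧ V i ≤ 4) (p : ℤ) (M : ℕ)
    (hp : 16 / 3 ≤ lamCF V p)
    (h : ∀ m, (lamCF V m ≤ lamCF V p ∧ |m - p| ≤ M) ∨ V m ≤ 3 ∨
      (p < m ∧ 3 ≤ V (m - 1)) ∨ (m < p ∧ 3 ≤ V (m + 1))) :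
    lamCF V p ∈ LSpecK 4 := by
  have hW : ∀ i, 1 ≤ windows V p i ∧ windows V p i ≤ 4 := fun i => hV _
  have hsmall : ∀ ε > 0, ∃ n : ℕ, 2 * (25 / 36 : ℝ) ^ n < ε := by
    intro ε hε
    obtain ⟨n, hn⟩ := exists_pow_lt_of_lt_one (half_pos hε) (show (25 / 36 : ℝ) < 1 by norm_num)
    exact ⟨n, by linarith⟩
  have hlow : ∀ i, 0 ≤ lamCF (windows V p) i := fun i => by
    have h1 := (cfVal_mem (a := fun n : ℕ => windows V p (i + 1 + n)) fun n => hW _).1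
    have h2 := (cfVal_mem (a := fun n : ℕ => windows V p (i - 1 - n)) fun n => hW _).1
    unfold lamCF
    positivity
  have hup : ∀ i, lamCF (windows V p) i ≤ 6 := fun i => by
    have h1 := lamCF_le hW i
    have h2 : (windows V p i : ℝ) ≤ 4 := by exact_mod_cast (hW i).2
    linarith
  refine ⟨windows V p, hW, le_antisymm ?_ ?_⟩
  · refine le_of_forall_pos_le_add fun ε hε => ?_
    obtain ⟨n, hn⟩ := hsmall ε hε
    rw [← sub_le_iff_le_add]
    refine le_limsup_of_frequently_le ?_ (isBoundedUnder_of ⟨6, hup⟩)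
    rw [frequently_atTop]
    intro N
    refine ⟨((n + N.toNat : ℕ) : ℤ) ^ 2 + (n + N.toNat : ℕ) + 0, ?_, ?_⟩
    · have := Int.self_le_toNat N
      push_cast
      nlinarith [sq_nonneg ((n : ℤ) + N.toNat)]
    · have := abs_lamCF_windows_sub_le hV p (k := n + N.toNat) (M := 0) (n := n) (by omega)
        (m := 0) (by simp)
      rw [abs_le, add_zero p] at this
      linarith
  · refine le_of_forall_pos_le_add fun ε hε => ?_
    obtain ⟨n, hn⟩ := hsmall ε hε
    refine limsup_le_of_le (isCoboundedUnder_le_of_le atTop hlow) ?_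
    filter_upwards [eventually_ge_atTop (((M + n : ℕ) : ℤ) ^ 2)] with i hi
    obtain ⟨k, hk, m, hm1, hm2, rfl⟩ := exists_window hi
    have hm := windows_apply V p hm1 hm2
    rcases h (p + m) with ⟨h1, h2⟩ | h3 | ⟨h4, h5⟩ | ⟨h6, h7⟩
    · have := abs_lamCF_windows_sub_le hV p hk (m := m) (by simpa using h2)
      rw [abs_le] at this
      linarith
    · have h8 := lamCF_le hW (k ^ 2 + k + m)
      have h9 : (V (p + m) : ℝ) ≤ 3 := by exact_mod_cast h3
      rw [hm] at h8
      linarith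
    · have := lamCF_le_of_three_le_left hW (i := k ^ 2 + k + m) (by
        have := windows_apply V p (k := k) (m := m - 1) (by omega) (by omega)
        rw [← add_sub_assoc, ← add_sub_assoc] at this
        rwa [this])
      linarith
    · have := lamCF_le_of_three_le_right hW (i := k ^ 2 + k + m) (by
        have := windows_apply V p (k := k) (m := m + 1) (by omega) (by omega)
        rw [← add_assoc, ← add_assoc] at this
        rwa [this])
      linarith

/-- The bi-infinite sequence `…, A 1, A 0, 4, 1, 4, …, 1, 4, B 0, B 1, …` with `N + 1` central
digits `4`, the first of them at position `0`. -/
def bridge (A B : ℕ → ℕ) (N : ℕ) (m : ℤ) : ℕ :=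
  if m < 0 then A (-m - 1).toNat
  else if 2 * N < m then B (m - 2 * N - 1).toNat
  else if m % 2 = 0 then 4 else 1

lemma bridge_digits {A B : ℕ → ℕ} (hA : Digits A) (hB : Digits B) (N : ℕ) (m : ℤ) :
    1 ≤ bridge A B N m ∧ bridge A B N m ≤ 4 := by
  unfold bridge
  split_ifs
  · exact hA _
  · exact hB _
  all_goals norm_num

lemma bridge_left (A B : ℕ → ℕ) (N n : ℕ) : bridge A B N (-1 - n) = A n := by
  unfold bridge
  rw [if_pos (by omega)]
  congr 1
  omega

lemma bridge_right (A B : ℕ → ℕ) (N n : ℕ) : bridge A B N (2 * N + 1 + n) = B n := by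
  unfold bridge
  rw [if_neg (by omega), if_pos (by omega)]
  congr 1
  omega

lemma bridge_even (A B : ℕ → ℕ) {N j : ℕ} (hj : j ≤ N) : bridge A B N (2 * j) = 4 := by
  unfold bridge
  rw [if_neg (by omega), if_neg (by omega), if_pos (by omega)]

lemma bridge_odd (A B : ℕ → ℕ) {N j : ℕ} (hj : j < N) : bridge A B N (2 * j + 1) = 1 := by
  unfold bridge
  rw [if_neg (by omega), if_neg (by omega), if_neg (by omega)]

lemma cfVal_eq_stepOneFour {a : ℕ → ℕ} (ha : Digits a) (h0 : a 0 = 1) (h1 : a 1 = 4) :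
    cfVal a = stepOneFour (cfVal fun i => a (i + 2)) := by
  rw [cfVal_eq ha, cfVal_eq ha.tail, h0, stepOneFour]
  simp [h1]

lemma cfVal_bridge_right {A B : ℕ → ℕ} (hA : Digits A) (hB : Digits B) (N : ℕ) {k : ℕ}
    (hk : k ≤ N) : cfVal (fun n : ℕ => bridge A B N (2 * (N - k : ℕ) + 1 + n)) =
      stepOneFour^[k] (cfVal B) := by
  induction k with
  | zero => simp only [Nat.sub_zero, bridge_right, Function.iterate_zero, id]
  | succ k ih =>
    rw [Function.iterate_succ_apply', ← ih (by omega),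
      cfVal_eq_stepOneFour (fun _ => bridge_digits hA hB N _)]
    · congr 3
      funext n
      congr 1
      push_cast [show k + 1 ≤ N from hk, show k ≤ N by omega]
      ring
    · simpa using bridge_odd A B (N := N) (j := N - (k + 1)) (by omega)
    · have := bridge_even A B (N := N) (j := N - k) (by omega)
      convert this using 2
      omega

lemma cfVal_bridge_left {A B : ℕ → ℕ} (hA : Digits A) (hB : Digits B) (N : ℕ) {k : ℕ}
    (hk : k ≤ N) : cfVal (fun n : ℕ => bridge A B N (2 * k - 1 - n)) =
      stepOneFour^[k] (cfVal A) := by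
  induction k with
  | zero =>
    have : (fun n : ℕ => bridge A B N (2 * (0 : ℕ) - 1 - n)) = A := by
      funext n
      simpa using bridge_left A B N n
    rw [this, Function.iterate_zero, id]
  | succ k ih =>
    rw [Function.iterate_succ_apply', ← ih (by omega),
      cfVal_eq_stepOneFour (fun _ => bridge_digits hA hB N _)]
    · congr 3
      funext n
      congr 1
      push_cast
      ring
    · have := bridge_odd A B (N := N) (j := k) (by omega)
      convert this using 2
      push_cast
      ring
    · have := bridge_even A B (N := N) (j := k) (by omega)
      convert this using 2
      push_cast
      ring

lemma lamCF_bridge {A B : ℕ → ℕ} (hA : Digits A) (hB : Digits B) {N j : ℕ} (hj : j ≤ N) :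
    lamCF (bridge A B N) (2 * j) =
      4 + stepOneFour^[N - j] (cfVal B) + stepOneFour^[j] (cfVal A) := by
  have h := cfVal_bridge_right hA hB N (k := N - j) (by omega)
  rw [show N - (N - j) = j by omega] at h
  unfold lamCF
  rw [h, cfVal_bridge_left hA hB N hj, bridge_even A B hj]
  norm_num

/-- Every digit `4` other than the first one is preceded by a digit at least `3`. -/
structure Admissible (a : ℕ → ℕ) : Prop where
  digits : Digits a
  prev : ∀ n, a (n + 1) = 4 → 3 ≤ a n

lemma Admissible.cfVal_le {a : ℕ → ℕ} (ha : Admissible a) : cfVal a ≤ 4 / 5 := by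
  rcases (ha.digits 0).1.eq_or_lt with h | h
  · have h1 : a 1 ≤ 3 := by
      have := ha.prev 0
      have := (ha.digits 1).2
      grind
    have h2 : (a 1 : ℝ) ≤ 3 := by exact_mod_cast h1
    have h3 := (ha.digits.cast_bounds 1).1
    have h4 := cfVal_mem ha.digits.tail.tail
    rw [cfVal_eq ha.digits, cfVal_eq ha.digits.tail, ← h]
    simp only [zero_add, Nat.cast_one]
    have h5 : 1 / 4 ≤ 1 / ((a 1 : ℝ) + cfVal fun i => a (i + 1 + 1)) :=
      one_div_le_one_div_of_le (by linarith) (by linarith)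
    rw [div_le_iff₀ (by linarith)]
    linarith
  · have := cfVal_le_one_div ha.digits (d := 2) (by norm_num) h
    push_cast at this
    linarith

lemma sum_mem_LSpecK {A B : ℕ → ℕ} (hA : Admissible A) (hB : Admissible B) {a b : ℕ}
    (hab : a = b ∨ a + 1 = b ∧ cfVal B ≤ cfVal A)
    (hsum : 4 / 3 ≤ stepOneFour^[a] (cfVal A) + stepOneFour^[b] (cfVal B)) :
    4 + stepOneFour^[b] (cfVal B) + stepOneFour^[a] (cfVal A) ∈ LSpecK 4 := by
  have hlam := fun {j : ℕ} (hj : j ≤ a + b) => lamCF_bridge hA.digits hB.digits hj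
  have ha := hlam (j := a) (by omega)
  rw [Nat.add_sub_cancel_left] at ha
  rw [← ha]
  refine lamCF_mem_LSpecK (bridge_digits hA.digits hB.digits _) _ (2 * (a + b))
    (by linarith) fun m => ?_
  have hdig := bridge_digits hA.digits hB.digits (a + b) m
  rcases lt_or_ge m 0 with hm | hm
  · obtain ⟨n, rfl⟩ : ∃ n : ℕ, m = -1 - n := ⟨(-1 - m).toNat, by omega⟩
    by_cases h4 : bridge A B (a + b) (-1 - n) ≤ 3
    · exact Or.inr (Or.inl h4)
    refine Or.inr (Or.inr (Or.inr ⟨by omega, ?_⟩))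
    cases n with
    | zero =>
      have := bridge_even A B (N := a + b) (j := 0) (by omega)
      simp at this ⊢
      omega
    | succ n =>
      rw [bridge_left] at h4 hdig
      rw [show (-1 - ((n + 1 : ℕ) : ℤ) + 1) = -1 - n by push_cast; ring, bridge_left]
      exact hA.prev n (by omega)
  rcases lt_or_ge (2 * (a + b : ℕ) : ℤ) m with hm' | hm'
  · obtain ⟨n, rfl⟩ : ∃ n : ℕ, m = 2 * (a + b : ℕ) + 1 + n :=
      ⟨(m - (2 * (a + b : ℕ) + 1)).toNat, by omega⟩
    by_cases h4 : bridge A B (a + b) (2 * (a + b : ℕ) + 1 + n) ≤ 3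
    · exact Or.inr (Or.inl h4)
    refine Or.inr (Or.inr (Or.inl ⟨by omega, ?_⟩))
    cases n with
    | zero =>
      have := bridge_even A B (N := a + b) (j := a + b) le_rfl
      rw [show (2 * ((a + b : ℕ) : ℤ) + 1 + (0 : ℕ) - 1) = 2 * (a + b : ℕ) by push_cast; ring, this]
      norm_num
    | succ n =>
      rw [bridge_right] at h4 hdig
      rw [show (2 * ((a + b : ℕ) : ℤ) + 1 + (n + 1 : ℕ) - 1) = 2 * (a + b : ℕ) + 1 + n by
        push_cast; ring, bridge_right]
      exact hB.prev n (by omega)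
  · obtain ⟨l, rfl⟩ := Int.eq_ofNat_of_zero_le hm
    rcases Nat.even_or_odd' l with ⟨j, rfl | rfl⟩
    · left
      refine ⟨?_, by rw [abs_le]; constructor <;> push_cast at * <;> omega⟩
      push_cast
      have h1 := hlam (j := j) (by omega)
      have h2 := iterate_add_le (cfVal_mem hA.digits).1 hA.cfVal_le (cfVal_mem hB.digits).1
        hB.cfVal_le hab (j := j) (by omega)
      linarith
    · right; left
      have := bridge_odd A B (N := a + b) (j := j) (by omega)
      push_cast
      omega

lemma admissible_of_mem_Dset {θ : ℕ → ℕ} (hθ : θ ∈ Dset) : Admissible θ := by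
  have hd : Digits θ := fun n => by
    have := hθ.1 n
    simp only [mem_insert_iff, mem_singleton_iff] at this
    omega
  refine ⟨hd, fun n hn => ?_⟩
  have h1 := hθ.2 n
  simp only [badPairs, mem_insert_iff, mem_singleton_iff, Prod.mk.injEq, hn, and_true] at h1
  have h2 := (hd n).1
  omega

lemma app_nil (θ : ℕ → ℕ) : app [] θ = θ := by
  funext n
  simp [app]

lemma app_cons_zero (d : ℕ) (b : List ℕ) (θ : ℕ → ℕ) : app (d :: b) θ 0 = d := by
  simp [app]

lemma app_cons_succ (d : ℕ) (b : List ℕ) (θ : ℕ → ℕ) (n : ℕ) :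
    app (d :: b) θ (n + 1) = app b θ n := by
  simp [app]

lemma app_append (b c : List ℕ) (θ : ℕ → ℕ) : app (b ++ c) θ = app b (app c θ) := by
  induction b with
  | nil => rw [List.nil_append, app_nil]
  | cons d b ih =>
    funext n
    cases n with
    | zero => rw [List.cons_append, app_cons_zero, app_cons_zero]
    | succ n => rw [List.cons_append, app_cons_succ, app_cons_succ, ih]

lemma Digits.cons {d : ℕ} (h1 : 1 ≤ d) (h4 : d ≤ 4) {b : List ℕ} {θ : ℕ → ℕ}
    (h : Digits (app b θ)) : Digits (app (d :: b) θ) := by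
  intro n
  cases n with
  | zero => exact ⟨by rwa [app_cons_zero], by rwa [app_cons_zero]⟩
  | succ n => rw [app_cons_succ]; exact h n

lemma cfVal_app_bW {θ : ℕ → ℕ} (hθ : Digits θ) (s : ℕ) :
    Digits (app (bW s) θ) ∧ cfVal (app (bW s) θ) = stepOneFour^[s] (cfVal θ) := by
  induction s with
  | zero => simpa [bW, app_nil] using hθ
  | succ s ih =>
    have hb : bW (s + 1) = 1 :: 4 :: bW s := by simp [bW, List.replicate_succ]
    have hd : Digits (app (bW (s + 1)) θ) := by
      rw [hb]
      exact (ih.1.cons (by norm_num) (by norm_num)).cons (by norm_num) (by norm_num)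
    refine ⟨hd, ?_⟩
    rw [cfVal_eq_stepOneFour hd (by rw [hb, app_cons_zero])
      (by rw [hb, app_cons_succ, app_cons_zero]), Function.iterate_succ_apply', ← ih.2]
    simp only [hb, app_cons_succ]

lemma Admissible.cons {d : ℕ} (h1 : 1 ≤ d) (h4 : d ≤ 4) {b : List ℕ} {θ : ℕ → ℕ}
    (h : Admissible (app b θ)) (hd : app b θ 0 = 4 → 3 ≤ d) : Admissible (app (d :: b) θ) := by
  refine ⟨h.digits.cons h1 h4, fun n hn => ?_⟩
  rw [app_cons_succ] at hn
  cases n with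
  | zero => rw [app_cons_zero]; exact hd hn
  | succ n => rw [app_cons_succ]; exact h.prev n hn

lemma Admissible.one_three {θ : ℕ → ℕ} (hθ : Admissible θ) : Admissible (app [1, 3] θ) := by
  have h : Admissible (app [] θ) := by rwa [app_nil]
  refine (h.cons (d := 3) (by norm_num) (by norm_num) fun _ => le_rfl).cons
    (by norm_num) (by norm_num) fun h3 => ?_
  simp [app_cons_zero] at h3

lemma cfVal_one_left {a : ℕ → ℕ} (ha : Digits a) (h0 : a 0 = 1) :
    cfVal a = 1 / (1 + 1 / (a 1 + cfVal fun i => a (i + 1 + 1))) := by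
  rw [cfVal_eq ha, cfVal_eq ha.tail, h0]
  simp

lemma three_fourths_le_cfVal_one_three {θ : ℕ → ℕ} (hθ : Admissible θ) :
    3 / 4 ≤ cfVal (app [1, 3] θ) := by
  have hd := hθ.one_three.digits
  have h0 := (cfVal_mem hd.tail.tail).1
  rw [cfVal_one_left hd (app_cons_zero _ _ _), app_cons_succ, app_cons_zero]
  have h1 : 1 / (((3 : ℕ) : ℝ) + cfVal fun i => app [1, 3] θ (i + 1 + 1)) ≤ 1 / 3 :=
    one_div_le_one_div_of_le (by norm_num) (by push_cast; linarith)
  have h2 : 0 ≤ 1 / (((3 : ℕ) : ℝ) + cfVal fun i => app [1, 3] θ (i + 1 + 1)) := by positivity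
  rw [le_div_iff₀ (by linarith)]
  linarith

lemma Admissible.cfVal_le_three_fourths {θ : ℕ → ℕ} (hθ : Admissible θ)
    (h : (θ 0, θ 1) ≠ (1, 3)) : cfVal θ ≤ 3 / 4 := by
  rcases (hθ.digits 0).1.eq_or_lt with h0 | h0
  · have h1 : θ 1 ≤ 2 := by
      have := hθ.prev 0
      have := (hθ.digits 1).2
      simp only [ne_eq, Prod.mk.injEq] at h
      grind
    have h2 : (θ 1 : ℝ) ≤ 2 := by exact_mod_cast h1
    have h3 := (hθ.digits.cast_bounds 1).1
    have h4 := cfVal_mem hθ.digits.tail.tail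
    rw [cfVal_one_left hθ.digits h0.symm]
    have h5 : 1 / 3 ≤ 1 / ((θ 1 : ℝ) + cfVal fun i => θ (i + 1 + 1)) :=
      one_div_le_one_div_of_le (by linarith) (by linarith)
    rw [div_le_iff₀ (by linarith)]
    linarith
  · have := cfVal_le_one_div hθ.digits (d := 2) (by norm_num) h0
    push_cast at this
    linarith

/-- For every `s ≥ 1`, both `4 + K̃(b^s) + K(c^s) ⊆ L(4)` and
`4 + K(b^s) + K(b^s) ⊆ L(4)`. -/
theorem sums_in_lagrange_four (s : ℕ) (hs : 1 ≤ s) :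
    {(4 : ℝ)} + Ktil (bW s) + Kb (cW s) ⊆ LSpecK 4 ∧
    {(4 : ℝ)} + Kb (bW s) + Kb (bW s) ⊆ LSpecK 4 := by
  constructor
  · rintro _ ⟨_, ⟨_, rfl, _, ⟨θ, hθ, -, hne, rfl⟩, rfl⟩, _, ⟨η, hη, -, rfl⟩, rfl⟩
    have hθ' := admissible_of_mem_Dset hθ
    have hη' := admissible_of_mem_Dset hη
    have h1 := three_fourths_le_cfVal_one_three hη'
    have h2 := hθ'.cfVal_le_three_fourths hne
    have h3 := iterate_mono_left (by linarith) hη'.one_three.cfVal_le (Nat.zero_le (s - 1))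
    have h4 := four_fifths_le_iterate (cfVal_mem hθ'.digits).1 hs
    have h := sum_mem_LSpecK hη'.one_three hθ' (a := s - 1) (b := s)
      (Or.inr ⟨by omega, by linarith⟩) (by
        simp only [Function.iterate_zero, id] at h3
        linarith)
    rw [← (cfVal_app_bW hθ'.digits s).2, ← (cfVal_app_bW hη'.one_three.digits (s - 1)).2,
      ← app_append] at h
    exact h
  · rintro _ ⟨_, ⟨_, rfl, _, ⟨θ, hθ, -, rfl⟩, rfl⟩, _, ⟨η, hη, -, rfl⟩, rfl⟩
    have hθ' := admissible_of_mem_Dset hθ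
    have hη' := admissible_of_mem_Dset hη
    have h3 := four_fifths_le_iterate (cfVal_mem hη'.digits).1 hs
    have h4 := four_fifths_le_iterate (cfVal_mem hθ'.digits).1 hs
    have h := sum_mem_LSpecK hη' hθ' (a := s) (b := s) (Or.inl rfl) (by linarith)
    rw [← (cfVal_app_bW hθ'.digits s).2, ← (cfVal_app_bW hη'.digits s).2] at h
    exact h
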